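/- For every integer ℓ ≥ 1, any smooth function u : J → ℂ satisfying −(1/r)(μ(r) r² (u/r)′)′ + ℓ(ℓ+1) u/r² = 0 on all of J is identically zero. (The restriction of the stationary operator at σ = s = m = 0 to the spherical harmonic sector ℓ ≥ 1 has trivial kernel.) -/

import Mathlib

open Set Filter Topology

/-- On a compact interval, a continuous `g` that is positive wherever the nonpositive continuous
function `h` vanishes dominates a nonnegative multiple of `h`. -/
theorem exists_nonneg_mul_le_of_pos_of_eq_zero {a b : ℝ} {g h : ℝ → ℝ}
    (hg : ContinuousOn g (Icc a b)) (hh : ContinuousOn h (Icc a b))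
    (hle : ∀ x ∈ Icc a b, h x ≤ 0) (hpos : ∀ x ∈ Icc a b, h x = 0 → 0 < g x) :
    ∃ K, 0 ≤ K ∧ ∀ x ∈ Icc a b, K * h x ≤ g x := by
  have hS : IsCompact (Icc a b ∩ g ⁻¹' Iic 0) :=
    isCompact_Icc.of_isClosed_subset (hg.preimage_isClosed_of_isClosed isClosed_Icc isClosed_Iic)
      inter_subset_left
  have hne : ∀ x ∈ Icc a b ∩ g ⁻¹' Iic 0, h x ≠ 0 := fun x hx h0 =>
    (hpos x hx.1 h0).not_ge hx.2
  obtain ⟨K, hK⟩ := hS.bddAbove_image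
    ((hg.mono inter_subset_left).div (hh.mono inter_subset_left) hne)
  refine ⟨max K 0, le_max_right _ _, fun x hx => ?_⟩
  by_cases hgx : g x ≤ 0
  · have hlt : h x < 0 := lt_of_le_of_ne (hle x hx) (hne x ⟨hx, hgx⟩)
    have hquot : g x / h x ≤ max K 0 :=
      (hK (mem_image_of_mem _ ⟨hx, hgx⟩)).trans (le_max_left _ _)
    exact (div_le_iff_of_neg hlt).1 hquot
  · exact (mul_nonpos_of_nonneg_of_nonpos (le_max_right _ _) (hle x hx)).trans (not_le.1 hgx).le

/-- Backward Grönwall inequality. -/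
theorem nonpos_of_neg_mul_le_deriv {a b K : ℝ} {F F' : ℝ → ℝ} (hab : a ≤ b)
    (hF : ContinuousOn F (Icc a b)) (hF' : ∀ x ∈ Ioo a b, HasDerivAt F (F' x) x)
    (hK : ∀ x ∈ Ioo a b, -K * F x ≤ F' x) (hb : F b ≤ 0) : F a ≤ 0 := by
  have hd : ∀ x ∈ Ioo a b, HasDerivAt (fun x => Real.exp (K * x) * F x)
      (Real.exp (K * x) * K * F x + Real.exp (K * x) * F' x) x := fun x hx =>
    (by simpa using ((hasDerivAt_id x).const_mul K).exp : HasDerivAt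
      (fun x => Real.exp (K * x)) (Real.exp (K * x) * K) x).mul (hF' x hx)
  have hmono : MonotoneOn (fun x => Real.exp (K * x) * F x) (Icc a b) := by
    refine monotoneOn_of_deriv_nonneg (convex_Icc a b)
      (ContinuousOn.mul (by fun_prop) hF) ?_ ?_ <;> rw [interior_Icc] <;> intro x hx
    · exact (hd x hx).differentiableAt.differentiableWithinAt
    · rw [(hd x hx).deriv]
      have := mul_nonneg (Real.exp_pos (K * x)).le (sub_nonneg.2 (hK x hx))
      linarith
  have h := hmono (left_mem_Icc.2 hab) (right_mem_Icc.2 hab) hab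
  simp only at h
  have h2 := mul_nonpos_of_nonneg_of_nonpos (Real.exp_pos (K * b)).le hb
  exact nonpos_of_mul_nonpos_right (h.trans h2) (Real.exp_pos _)

/-- Forward Grönwall inequality. -/
theorem nonpos_of_deriv_le_mul {a b K : ℝ} {F F' : ℝ → ℝ} (hab : a ≤ b)
    (hF : ContinuousOn F (Icc a b)) (hF' : ∀ x ∈ Ioo a b, HasDerivAt F (F' x) x)
    (hK : ∀ x ∈ Ioo a b, F' x ≤ K * F x) (ha : F a ≤ 0) : F b ≤ 0 := by
  have hmem : ∀ x ∈ Ioo (-b) (-a), -x ∈ Ioo a b := fun x hx =>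
    ⟨by linarith [hx.2], by linarith [hx.1]⟩
  have := nonpos_of_neg_mul_le_deriv (a := -b) (b := -a) (K := K) (F := fun x => F (-x))
    (F' := fun x => -F' (-x)) (by linarith)
    (hF.comp (by fun_prop) fun x hx => ⟨by linarith [hx.2], by linarith [hx.1]⟩)
    (fun x hx => by
      simpa [Function.comp_def] using (hF' _ (hmem x hx)).comp x (hasDerivAt_neg x))
    (fun x hx => by linarith [hK _ (hmem x hx)]) (by simpa using ha)
  simpa using this

/-- A function that is positive to the right of a simple zero `c` and has no zero on `[x, c)` is
increasing at `c` and negative at `x`. -/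
theorem neg_of_simple_zero {f : ℝ → ℝ} {x c e d : ℝ} (hxc : x < c) (hce : c < e)
    (hf : ContinuousOn f (Icc x c)) (hne : ∀ y ∈ Ico x c, f y ≠ 0) (hc : f c = 0)
    (hpos : ∀ y ∈ Ioo c e, 0 < f y) (hd : HasDerivAt f d c) (hd0 : d ≠ 0) :
    f x < 0 ∧ 0 < d := by
  constructor
  · by_contra hx
    have hx' : 0 < f x := lt_of_le_of_ne (not_lt.1 hx) (hne x ⟨le_rfl, hxc⟩).symm
    have hleft : ∀ y ∈ Ico x c, 0 ≤ f y := by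
      intro y hy
      by_contra hy0
      obtain ⟨z, hz, hz0⟩ := intermediate_value_Icc' hy.1
        (hf.mono (Icc_subset_Icc_right hy.2.le)) ⟨(not_le.1 hy0).le, hx'.le⟩
      exact hne z ⟨hz.1, hz.2.trans_lt hy.2⟩ hz0
    have hmin : IsLocalMin f c := by
      filter_upwards [Ioo_mem_nhds hxc hce] with y hy
      rw [hc]
      rcases lt_trichotomy y c with h | h | h
      · exact hleft y ⟨hy.1.le, h⟩
      · rw [h, hc]
      · exact (hpos y ⟨h, hy.2⟩).le
    exact hd0 (hmin.hasDerivAt_eq_zero hd)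
  · refine lt_of_le_of_ne ?_ hd0.symm
    have ht : Tendsto (slope f c) (𝓝[>] c) (𝓝 d) :=
      (hasDerivAt_iff_tendsto_slope.1 hd).mono_left
        (nhdsWithin_mono _ fun y (hy : c < y) => hy.ne')
    refine ge_of_tendsto ht ?_
    filter_upwards [Ioo_mem_nhdsGT hce] with y hy
    rw [slope_def_field, hc, sub_zero]
    exact div_nonneg (hpos y hy).le (sub_nonneg.2 hy.1.le)

/-- The energy `L v² - μ (u' - v)²` with `v = u / r` attached to `μ' (u' - v) + μ u'' = L v / r`. -/
noncomputable def radialEnergy (L : ℝ) (μ u u₁ : ℝ → ℝ) (r : ℝ) : ℝ :=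
  L * (u r / r) ^ 2 - μ r * (u₁ r - u r / r) ^ 2

theorem hasDerivAt_div_id {u u₁ : ℝ → ℝ} {r : ℝ} (hr : r ≠ 0) (hu : HasDerivAt u (u₁ r) r) :
    HasDerivAt (fun t => u t / t) ((u₁ r - u r / r) / r) r := by
  refine (hu.div (hasDerivAt_id r) hr).congr_deriv ?_
  simp only [id]
  field_simp

theorem hasDerivAt_radialEnergy {L : ℝ} {μ μ₁ u u₁ u₂ : ℝ → ℝ} {r : ℝ} (hr : r ≠ 0)
    (hμ : HasDerivAt μ (μ₁ r) r) (hu : HasDerivAt u (u₁ r) r) (hu₁ : HasDerivAt u₁ (u₂ r) r)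
    (heq : μ₁ r * (u₁ r - u r / r) + μ r * u₂ r = L * u r / r ^ 2) :
    HasDerivAt (radialEnergy L μ u u₁) ((μ₁ r + 2 * μ r / r) * (u₁ r - u r / r) ^ 2) r := by
  have hv := hasDerivAt_div_id hr hu
  refine (((hv.pow 2).const_mul L).sub (hμ.mul ((hu₁.sub hv).pow 2))).congr_deriv ?_
  have h2 : μ r * u₂ r = L * u r / r ^ 2 - μ₁ r * (u₁ r - u r / r) := by linarith
  simp only [Pi.sub_apply, Pi.pow_apply]
  push_cast
  generalize hy : u₁ r - u r / r = y at *
  generalize hw : u r / r = v at *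
  have h3 : L * u r / r ^ 2 = L * v / r := by rw [← hw]; field_simp
  rw [h3] at h2
  linear_combination (-2 * y) * h2

theorem eq_zero_of_radialEnergy_nonpos {L : ℝ} {μ u u₁ : ℝ → ℝ} {r : ℝ} (hL : 0 < L)
    (hr : r ≠ 0) (hμ : μ r ≤ 0) (h : radialEnergy L μ u u₁ r ≤ 0) : u r = 0 := by
  have h1 : L * (u r / r) ^ 2 ≤ 0 := by
    have := mul_nonneg (neg_nonneg.2 hμ) (sq_nonneg (u₁ r - u r / r))
    unfold radialEnergy at h
    linarith
  have h2 : (u r / r) ^ 2 = 0 := le_antisymm (nonpos_of_mul_nonpos_right h1 hL) (sq_nonneg _)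
  simpa [hr] using h2

/-- Uniqueness to the left of a point `b` at which the energy vanishes. -/
theorem radial_eq_zero_left {L a b : ℝ} {μ μ₁ u u₁ u₂ : ℝ → ℝ} (hL : 0 < L) (hab : a < b)
    (ha : a ≠ 0) (h0 : 0 ∉ Ioo a b)
    (hμ : ∀ r ∈ Icc a b, HasDerivAt μ (μ₁ r) r) (hμ₁ : ContinuousOn μ₁ (Icc a b))
    (hu : ∀ r ∈ Icc a b, HasDerivAt u (u₁ r) r) (hu₁ : ∀ r ∈ Icc a b, HasDerivAt u₁ (u₂ r) r)
    (hv : ContinuousOn (fun r => u r / r) (Icc a b))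
    (heq : ∀ r ∈ Ioo a b, μ₁ r * (u₁ r - u r / r) + μ r * u₂ r = L * u r / r ^ 2)
    (hneg : ∀ r ∈ Ico a b, μ r < 0) (hb : μ b < 0 ∨ μ b = 0 ∧ 0 < μ₁ b)
    (hFb : radialEnergy L μ u u₁ b = 0) : u a = 0 := by
  have hμc : ContinuousOn μ (Icc a b) := fun r hr => (hμ r hr).continuousAt.continuousWithinAt
  have hu₁c : ContinuousOn u₁ (Icc a b) := fun r hr => (hu₁ r hr).continuousAt.continuousWithinAt
  have hle : ∀ r ∈ Icc a b, μ r ≤ 0 ∧ (μ r = 0 → 0 < μ₁ r) := by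
    intro r hr
    rcases hr.2.lt_or_eq with h | rfl
    · have := hneg r ⟨hr.1, h⟩
      exact ⟨this.le, fun h => absurd h this.ne⟩
    · rcases hb with h | h
      · exact ⟨h.le, fun h' => absurd h' h.ne⟩
      · exact ⟨h.1.le, fun _ => h.2⟩
  obtain ⟨K, hK0, hK⟩ := exists_nonneg_mul_le_of_pos_of_eq_zero hμ₁ hμc
    (fun r hr => (hle r hr).1) (fun r hr => (hle r hr).2)
  refine eq_zero_of_radialEnergy_nonpos (μ := μ) (u₁ := u₁) hL ha
    (hneg a ⟨le_rfl, hab⟩).le ?_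
  refine nonpos_of_neg_mul_le_deriv (K := K + 2 / |a|)
    (F' := fun r => (μ₁ r + 2 * μ r / r) * (u₁ r - u r / r) ^ 2) hab.le
    (ContinuousOn.sub (continuousOn_const.mul (hv.pow 2)) (hμc.mul ((hu₁c.sub hv).pow 2)))
    (fun r hr => ?_) (fun r hr => ?_) hFb.le
  · have hr' := Ioo_subset_Icc_self hr
    exact hasDerivAt_radialEnergy (fun h => h0 (h ▸ hr)) (hμ r hr') (hu r hr') (hu₁ r hr')
      (heq r hr)
  · have hr0 : r ≠ 0 := fun h => h0 (h ▸ hr)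
    have hμr := hneg r ⟨hr.1.le, hr.2⟩
    have hinv : 1 / r ≤ 1 / |a| := by
      rcases hr0.lt_or_gt with h | h
      · exact (one_div_neg.2 h).le.trans (by positivity)
      · have ha0 : 0 < a := lt_of_le_of_ne (not_lt.1 fun h' => h0 ⟨h', h.trans hr.2⟩) ha.symm
        rw [abs_of_pos ha0]
        exact one_div_le_one_div_of_le ha0 hr.1.le
    have hcoef : (K + 2 / |a|) * μ r ≤ μ₁ r + 2 * μ r / r := by
      have h1 := hK r (Ioo_subset_Icc_self hr)
      have h2 := mul_le_mul_of_nonpos_left hinv hμr.le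
      have h3 : 2 / |a| * μ r = 2 * (μ r * (1 / |a|)) := by ring
      have h4 : 2 * μ r / r = 2 * (μ r * (1 / r)) := by ring
      rw [add_mul, h3, h4]
      linarith
    have h5 := mul_le_mul_of_nonneg_right hcoef (sq_nonneg (u₁ r - u r / r))
    have h6 : 0 ≤ (K + 2 / |a|) * (L * (u r / r) ^ 2) := by positivity
    unfold radialEnergy
    linarith

/-- Uniqueness to the right of a positive simple zero `a` of `μ` at which the solution vanishes. -/
theorem radial_eq_zero_right {L a b : ℝ} {μ μ₁ u u₁ u₂ : ℝ → ℝ} (hL : 0 < L) (hab : a < b)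
    (ha : 0 < a)
    (hμ : ∀ r ∈ Icc a b, HasDerivAt μ (μ₁ r) r) (hμ₁ : ContinuousOn μ₁ (Icc a b))
    (hu : ∀ r ∈ Icc a b, HasDerivAt u (u₁ r) r) (hu₁ : ∀ r ∈ Icc a b, HasDerivAt u₁ (u₂ r) r)
    (heq : ∀ r ∈ Ioo a b, μ₁ r * (u₁ r - u r / r) + μ r * u₂ r = L * u r / r ^ 2)
    (hneg : ∀ r ∈ Ioc a b, μ r < 0) (hμa : μ a = 0) (hμ₁a : μ₁ a < 0) (hua : u a = 0) :
    u b = 0 := by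
  have hμc : ContinuousOn μ (Icc a b) := fun r hr => (hμ r hr).continuousAt.continuousWithinAt
  have hle : ∀ r ∈ Icc a b, μ r ≤ 0 ∧ (μ r = 0 → 0 < -μ₁ r) := by
    intro r hr
    rcases hr.1.lt_or_eq with h | rfl
    · have := hneg r ⟨h, hr.2⟩
      exact ⟨this.le, fun h => absurd h this.ne⟩
    · exact ⟨hμa.le, fun _ => neg_pos.2 hμ₁a⟩
  obtain ⟨K, hK0, hK⟩ := exists_nonneg_mul_le_of_pos_of_eq_zero hμ₁.neg hμc
    (fun r hr => (hle r hr).1) (fun r hr => (hle r hr).2)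
  have hd : ∀ r ∈ Icc a b, r ≠ 0 := fun r hr => (ha.trans_le hr.1).ne'
  have hF : ContinuousOn (radialEnergy L μ u u₁) (Icc a b) := by
    have hv : ContinuousOn (fun r => u r / r) (Icc a b) := fun r hr =>
      (hasDerivAt_div_id (hd r hr) (hu r hr)).continuousAt.continuousWithinAt
    have hu₁c : ContinuousOn u₁ (Icc a b) := fun r hr =>
      (hu₁ r hr).continuousAt.continuousWithinAt
    exact ContinuousOn.sub (continuousOn_const.mul (hv.pow 2)) (hμc.mul ((hu₁c.sub hv).pow 2))
  refine eq_zero_of_radialEnergy_nonpos (μ := μ) (u₁ := u₁) hL (ha.trans hab).ne'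
    (hneg b ⟨hab, le_rfl⟩).le ?_
  refine nonpos_of_deriv_le_mul (K := K)
    (F' := fun r => (μ₁ r + 2 * μ r / r) * (u₁ r - u r / r) ^ 2) hab.le hF
    (fun r hr => ?_) (fun r hr => ?_) (by simp [radialEnergy, hua, hμa])
  · have hr' := Ioo_subset_Icc_self hr
    exact hasDerivAt_radialEnergy (hd r hr') (hμ r hr') (hu r hr') (hu₁ r hr') (heq r hr)
  · have hμr := hneg r ⟨hr.1, hr.2.le⟩
    have hcoef : μ₁ r + 2 * μ r / r ≤ -K * μ r := by
      have h1 : K * μ r ≤ -μ₁ r := hK r (Ioo_subset_Icc_self hr)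
      have h2 : 2 * μ r / r ≤ 0 :=
        div_nonpos_of_nonpos_of_nonneg (by linarith) (ha.trans hr.1).le
      linarith
    have h5 := mul_le_mul_of_nonneg_right hcoef (sq_nonneg (u₁ r - u r / r))
    have h6 : 0 ≤ K * (L * (u r / r) ^ 2) := by positivity
    unfold radialEnergy
    linarith

/-- Between two positive zeros of `μ` the flux identity forces a solution to vanish. -/
theorem radial_eq_zero_between {L a b : ℝ} {μ μ₁ u u₁ u₂ : ℝ → ℝ} (hL : 0 < L) (hab : a < b)
    (ha : 0 < a)
    (hμ : ∀ r ∈ Icc a b, HasDerivAt μ (μ₁ r) r)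
    (hu : ∀ r ∈ Icc a b, HasDerivAt u (u₁ r) r) (hu₁ : ∀ r ∈ Icc a b, HasDerivAt u₁ (u₂ r) r)
    (heq : ∀ r ∈ Ioo a b, μ₁ r * (u₁ r - u r / r) + μ r * u₂ r = L * u r / r ^ 2)
    (hpos : ∀ r ∈ Ioo a b, 0 < μ r) (hμa : μ a = 0) (hμb : μ b = 0) :
    ∀ r ∈ Icc a b, u r = 0 := by
  have hd : ∀ r ∈ Icc a b, r ≠ 0 := fun r hr => (ha.trans_le hr.1).ne'
  set G : ℝ → ℝ := fun r => μ r * (r * (u₁ r - u r / r) * (u r / r)) with hG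
  have hG' : ∀ r ∈ Ioo a b,
      HasDerivAt G (L * (u r / r) ^ 2 + μ r * (u₁ r - u r / r) ^ 2) r := by
    intro r hr
    have hr' := Ioo_subset_Icc_self hr
    have hr0 := hd r hr'
    have hv := hasDerivAt_div_id hr0 (hu r hr')
    refine ((hμ r hr').mul (((hasDerivAt_id r).mul ((hu₁ r hr').sub hv)).mul hv)).congr_deriv ?_
    have h2 := heq r hr
    simp only [Pi.sub_apply, Pi.mul_apply, id]
    generalize hy : u₁ r - u r / r = y at *
    generalize hw : u r / r = v at *
    have h3 : L * u r / r ^ 2 = L * v / r := by rw [← hw]; field_simp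
    rw [h3] at h2
    have h4 : L * v / r * r = L * v := by field_simp
    have h5 : y / r * r = y := by field_simp
    linear_combination (r * v) * h2 + v * h4 + (μ r * y - μ r * v) * h5
  have hGc : ContinuousOn G (Icc a b) := fun r hr =>
    ((hμ r hr).continuousAt.mul ((continuousAt_id.mul ((hu₁ r hr).continuousAt.sub
      (hasDerivAt_div_id (hd r hr) (hu r hr)).continuousAt)).mul
      (hasDerivAt_div_id (hd r hr) (hu r hr)).continuousAt)).continuousWithinAt
  have hmono : MonotoneOn G (Icc a b) := by
    refine monotoneOn_of_deriv_nonneg (convex_Icc a b) hGc ?_ ?_ <;> rw [interior_Icc] <;>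
      intro r hr
    · exact (hG' r hr).differentiableAt.differentiableWithinAt
    · rw [(hG' r hr).deriv]
      have := hpos r hr
      positivity
  have hG0 : ∀ r ∈ Icc a b, G r = 0 := fun r hr => le_antisymm
    ((hmono hr (right_mem_Icc.2 hab.le) hr.2).trans (by simp [hG, hμb]))
    (le_trans (by simp [hG, hμa]) (hmono (left_mem_Icc.2 hab.le) hr hr.1))
  have hint : ∀ r ∈ Ioo a b, u r = 0 := by
    intro r hr
    have hz : L * (u r / r) ^ 2 + μ r * (u₁ r - u r / r) ^ 2 = 0 := by
      refine (hG' r hr).unique ((hasDerivAt_const r (0 : ℝ)).congr_of_eventuallyEq ?_)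
      filter_upwards [Ioo_mem_nhds hr.1 hr.2] with x hx
      exact hG0 x (Ioo_subset_Icc_self hx)
    have h1 := mul_nonneg (hpos r hr).le (sq_nonneg (u₁ r - u r / r))
    have h2 : (u r / r) ^ 2 = 0 :=
      le_antisymm (nonpos_of_mul_nonpos_right (by linarith) hL) (sq_nonneg _)
    simpa [hd r (Ioo_subset_Icc_self hr)] using h2
  have huc : ContinuousOn u (Icc a b) := fun r hr => (hu r hr).continuousAt.continuousWithinAt
  have hsub : Icc a b ⊆ closure (Ioo a b) := (closure_Ioo hab.ne).ge
  exact fun r hr => Set.EqOn.of_subset_closure (f := u) (g := fun _ => 0) hint huc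
    continuousOn_const Ioo_subset_Icc_self hsub hr

/-- Real form of the triviality of the kernel. -/
theorem radial_eq_zero {rm rp A B L : ℝ} (hrm : 0 < rm) (hrmp : rm < rp) (hA : A < rm)
    (hB : rp < B) (hL : 0 < L) {μ μ₁ u u₁ u₂ : ℝ → ℝ}
    (hμ : ∀ r ∈ Ioo A B, HasDerivAt μ (μ₁ r) r) (hμ₁ : ContinuousOn μ₁ (Ioo A B))
    (hμm : μ rm = 0) (hμp : μ rp = 0) (hμm' : μ₁ rm ≠ 0) (hμp' : μ₁ rp ≠ 0)
    (hμpos : ∀ r ∈ Ioo rm rp, 0 < μ r) (hμne : ∀ r ∈ Ioo A B \ Icc rm rp, μ r ≠ 0)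
    (hu : ∀ r ∈ Ioo A B, HasDerivAt u (u₁ r) r) (hu₁ : ∀ r ∈ Ioo A B, HasDerivAt u₁ (u₂ r) r)
    (heq : ∀ r ∈ Ioo A B, r ≠ 0 →
      μ₁ r * (u₁ r - u r / r) + μ r * u₂ r = L * u r / r ^ 2) :
    ∀ r ∈ Ioo A B, u r = 0 := by
  have hrmJ : rm ∈ Ioo A B := ⟨hA, hrmp.trans hB⟩
  have hrpJ : rp ∈ Ioo A B := ⟨hA.trans hrmp, hB⟩
  have hsub : ∀ {x y}, x ∈ Ioo A B → y ∈ Ioo A B → Icc x y ⊆ Ioo A B := fun hx hy =>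
    Icc_subset_Ioo hx.1 hy.2
  have hμc : ContinuousOn μ (Ioo A B) := fun r hr => (hμ r hr).continuousAt.continuousWithinAt
  have hleft : ∀ x ∈ Ioo A rm, μ x < 0 ∧ 0 < μ₁ rm := fun x hx =>
    have hxJ : x ∈ Ioo A B := ⟨hx.1, hx.2.trans hrmJ.2⟩
    neg_of_simple_zero hx.2 hrmp (hμc.mono (hsub hxJ hrmJ))
      (fun y hy => hμne y ⟨hsub hxJ hrmJ ⟨hy.1, hy.2.le⟩, fun h => hy.2.not_ge h.1⟩)
      hμm hμpos (hμ rm hrmJ) hμm'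
  have hright : ∀ x ∈ Ioo rp B, μ x < 0 ∧ μ₁ rp < 0 := by
    intro x hx
    have hxJ : x ∈ Ioo A B := ⟨hrpJ.1.trans hx.1, hx.2⟩
    have hd : HasDerivAt (fun y => μ (-y)) (-μ₁ rp) (-rp) := by
      have h : HasDerivAt μ (μ₁ rp) (-(-rp)) := by simpa using hμ rp hrpJ
      simpa [Function.comp_def] using h.comp (-rp) (hasDerivAt_neg (-rp))
    have := neg_of_simple_zero (f := fun y => μ (-y)) (x := -x) (c := -rp) (e := -rm)
      (by linarith [hx.1]) (by linarith)
      (hμc.comp (by fun_prop) fun y hy =>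
        hsub hrpJ hxJ ⟨by linarith [hy.2], by linarith [hy.1]⟩)
      (fun y hy => hμne _ ⟨hsub hrpJ hxJ ⟨by linarith [hy.2], by linarith [hy.1]⟩,
        fun h => by linarith [h.2, hy.2]⟩)
      (by simpa using hμp) (fun y hy => hμpos _ ⟨by linarith [hy.2], by linarith [hy.1]⟩)
      hd (neg_ne_zero.2 hμp')
    simpa using this
  have hmid : ∀ r ∈ Icc rm rp, u r = 0 :=
    have hJ := hsub hrmJ hrpJ
    radial_eq_zero_between hL hrmp hrm (fun r hr => hμ r (hJ hr)) (fun r hr => hu r (hJ hr))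
      (fun r hr => hu₁ r (hJ hr))
      (fun r hr => heq r (hJ (Ioo_subset_Icc_self hr)) (hrm.trans hr.1).ne') hμpos hμm hμp
  have hpos : ∀ r ∈ Ioo A B, 0 < r → r ≤ rm → u r = 0 := by
    intro x hx hx0 hxr
    rcases hxr.lt_or_eq with hlt | rfl
    · have hJ := hsub hx hrmJ
      have hne : ∀ r ∈ Icc x rm, r ≠ 0 := fun r hr => (hx0.trans_le hr.1).ne'
      exact radial_eq_zero_left hL hlt hx0.ne' (fun h => hx0.not_gt h.1)
        (fun r hr => hμ r (hJ hr)) (hμ₁.mono hJ) (fun r hr => hu r (hJ hr))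
        (fun r hr => hu₁ r (hJ hr))
        (fun r hr =>
          (hasDerivAt_div_id (hne r hr) (hu r (hJ hr))).continuousAt.continuousWithinAt)
        (fun r hr => heq r (hJ (Ioo_subset_Icc_self hr)) (hne r (Ioo_subset_Icc_self hr)))
        (fun r hr => (hleft r ⟨hx.1.trans_le hr.1, hr.2⟩).1)
        (Or.inr ⟨hμm, (hleft x ⟨hx.1, hlt⟩).2⟩)
        (by simp [radialEnergy, hμm, hmid rm ⟨le_rfl, hrmp.le⟩])
    · exact hmid x ⟨le_rfl, hrmp.le⟩
  have hzero : (0 : ℝ) ∈ Ioo A B → u 0 = 0 ∧ u₁ 0 = 0 := by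
    intro h0
    have hlim : ∀ f : ℝ → ℝ, ContinuousAt f 0 → (∀ r ∈ Ioo 0 rm, f r = 0) → f 0 = 0 := by
      intro f hf hz
      refine tendsto_nhds_unique (hf.tendsto.mono_left (nhdsWithin_le_nhds (s := Ioi 0)))
        (tendsto_const_nhds.congr' ?_)
      filter_upwards [Ioo_mem_nhdsGT hrm] with r hr
      exact (hz r hr).symm
    have hJ : ∀ r ∈ Ioo 0 rm, r ∈ Ioo A B := fun r hr =>
      ⟨h0.1.trans hr.1, hr.2.trans hrmJ.2⟩
    refine ⟨hlim u (hu 0 h0).continuousAt fun r hr => hpos r (hJ r hr) hr.1 hr.2.le,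
      hlim u₁ (hu₁ 0 h0).continuousAt fun r hr => ?_⟩
    refine (hu r (hJ r hr)).unique ((hasDerivAt_const r (0 : ℝ)).congr_of_eventuallyEq ?_)
    filter_upwards [Ioo_mem_nhds hr.1 hr.2] with x hx
    exact hpos x (hJ x hx) hx.1 hx.2.le
  intro x hx
  rcases lt_trichotomy x 0 with hx0 | rfl | hx0
  · have h0J : (0 : ℝ) ∈ Ioo A B := ⟨hx.1.trans hx0, hrm.trans hrmJ.2⟩
    obtain ⟨hu0, hu₁0⟩ := hzero h0J
    have hJ := hsub hx h0J
    refine radial_eq_zero_left hL hx0 hx0.ne (fun h => h.2.ne rfl)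
      (fun r hr => hμ r (hJ hr)) (hμ₁.mono hJ) (fun r hr => hu r (hJ hr))
      (fun r hr => hu₁ r (hJ hr)) (fun r hr => ContinuousAt.continuousWithinAt ?_)
      (fun r hr => heq r (hJ (Ioo_subset_Icc_self hr)) hr.2.ne)
      (fun r hr => (hleft r ⟨hx.1.trans_le hr.1, hr.2.trans hrm⟩).1)
      (Or.inl (hleft 0 ⟨h0J.1, hrm⟩).1) (by simp [radialEnergy, hu0, hu₁0])
    rcases hr.2.lt_or_eq with h | rfl
    · exact (hasDerivAt_div_id h.ne (hu r (hJ hr))).continuousAt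
    · rw [continuousAt_iff_punctured_nhds]
      have := hasDerivAt_iff_tendsto_slope.1 (hu 0 h0J)
      rw [hu₁0] at this
      simpa [slope_fun_def_field, hu0] using this
  · exact (hzero hx).1
  · rcases le_or_gt x rm with h | h
    · exact hpos x hx hx0 h
    · rcases le_or_gt x rp with h' | h'
      · exact hmid x ⟨h.le, h'⟩
      · have hJ := hsub hrpJ hx
        have hrp : 0 < rp := hrm.trans hrmp
        exact radial_eq_zero_right hL h' hrp (fun r hr => hμ r (hJ hr)) (hμ₁.mono hJ)
          (fun r hr => hu r (hJ hr)) (fun r hr => hu₁ r (hJ hr))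
          (fun r hr => heq r (hJ (Ioo_subset_Icc_self hr)) (hrp.trans hr.1).ne')
          (fun r hr => (hright r ⟨hr.1, hr.2.trans_lt hx.2⟩).1) hμp
          (hright x ⟨h', hx.2⟩).2 (hmid rp ⟨hrmp.le, le_rfl⟩)

/-- for every integer `ℓ ≥ 1`, any smooth `u : J → ℂ` with
`−(1/r)(μ r²(u/r)′)′ + ℓ(ℓ+1)u/r² = 0` on `J` vanishes identically
(the sector `ℓ ≥ 1` of `P̂(0,0,0)` has trivial kernel). -/
theorem stmt1 (rm rp η₀ : ℝ) (hrm : 0 < rm) (hrmp : rm < rp) (hη : 0 < η₀)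
    (J : Set ℝ) (hJ : J = Set.Ioo (rm - η₀) (rp + η₀))
    (μ : ℝ → ℝ) (hμ : ContDiffOn ℝ (⊤ : ℕ∞) μ J)
    (hμm : μ rm = 0) (hμp : μ rp = 0)
    (hμm' : deriv μ rm ≠ 0) (hμp' : deriv μ rp ≠ 0)
    (hμpos : ∀ r ∈ Set.Ioo rm rp, 0 < μ r)
    (hμne : ∀ r ∈ J \ Set.Icc rm rp, μ r ≠ 0)
    (ℓ : ℕ) (hℓ : 1 ≤ ℓ)
    (u : ℝ → ℂ) (hu : ContDiffOn ℝ (⊤ : ℕ∞) u J)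
    (heq : ∀ r ∈ J,
      -(1 / (r : ℂ)) *
          deriv (fun t : ℝ => ((μ t * t ^ 2 : ℝ) : ℂ) * deriv (fun x : ℝ => u x / (x : ℂ)) t) r +
        ((ℓ * (ℓ + 1) : ℕ) : ℂ) * u r / (r : ℂ) ^ 2 = 0) :
    ∀ r ∈ J, u r = 0 := by
  subst hJ
  have hopen : IsOpen (Ioo (rm - η₀) (rp + η₀)) := isOpen_Ioo
  have hd : ∀ {E : Type} [NormedAddCommGroup E] [NormedSpace ℝ E] {f : ℝ → E},
      ContDiffOn ℝ (⊤ : ℕ∞) f (Ioo (rm - η₀) (rp + η₀)) →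
      (∀ r ∈ Ioo (rm - η₀) (rp + η₀), HasDerivAt f (deriv f r) r) ∧
      ContDiffOn ℝ (⊤ : ℕ∞) (deriv f) (Ioo (rm - η₀) (rp + η₀)) := by
    intro E _ _ f hf
    exact ⟨fun r hr => ((hf.differentiableOn (by simp)).differentiableAt
      (hopen.mem_nhds hr)).hasDerivAt, hf.deriv_of_isOpen hopen (by simp)⟩
  obtain ⟨hμd, hμ₁⟩ := hd hμ
  obtain ⟨hud, hu₁⟩ := hd hu
  obtain ⟨hu₁d, -⟩ := hd hu₁
  set L : ℝ := ((ℓ * (ℓ + 1) : ℕ) : ℝ) with hLdef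
  have hL : 0 < L := by
    have : 0 < ℓ * (ℓ + 1) := by positivity
    rw [hLdef]
    exact_mod_cast this
  have hode : ∀ r ∈ Ioo (rm - η₀) (rp + η₀), r ≠ 0 →
      ((deriv μ r : ℝ) : ℂ) * (deriv u r - u r / r) + μ r * deriv (deriv u) r =
        L * u r / (r : ℂ) ^ 2 := by
    intro r hr hr0
    have hrc : (r : ℂ) ≠ 0 := by exact_mod_cast hr0
    have hv : ∀ t ∈ Ioo (rm - η₀) (rp + η₀), t ≠ 0 →
        HasDerivAt (fun x : ℝ => u x / (x : ℂ))
          ((deriv u t * t - u t) / (t : ℂ) ^ 2) t := by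
      intro t ht ht0
      refine ((hud t ht).div (Complex.ofRealCLM.hasDerivAt (x := t))
        (by simpa using ht0)).congr_deriv ?_
      simp
    have hcongr : (fun t : ℝ => ((μ t * t ^ 2 : ℝ) : ℂ) * deriv (fun x : ℝ => u x / (x : ℂ)) t)
        =ᶠ[𝓝 r] fun t : ℝ => (μ t : ℂ) * (deriv u t * t - u t) := by
      filter_upwards [hopen.mem_nhds hr, isOpen_ne.mem_nhds hr0] with t ht ht0
      have htc : (t : ℂ) ≠ 0 := by exact_mod_cast ht0
      rw [(hv t ht ht0).deriv]
      push_cast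
      field_simp
    have hw := (hμd r hr).ofReal_comp.mul
      (((hu₁d r hr).mul (Complex.ofRealCLM.hasDerivAt (x := r))).sub (hud r hr))
    have hw' : deriv (fun t : ℝ => (μ t : ℂ) * (deriv u t * t - u t)) r =
        ((deriv μ r : ℝ) : ℂ) * (deriv u r * r - u r) + μ r * (deriv (deriv u) r * r) := by
      refine (HasDerivAt.congr_deriv hw ?_).deriv
      simp
    have h := heq r hr
    rw [hcongr.deriv_eq, hw'] at h
    have hLc : ((ℓ * (ℓ + 1) : ℕ) : ℂ) = (L : ℂ) := by rw [hLdef]; push_cast; ring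
    rw [hLc] at h
    field_simp at h ⊢
    linear_combination -h
  have hreal : ∀ φ : ℂ →L[ℝ] ℝ, ∀ r ∈ Ioo (rm - η₀) (rp + η₀), φ (u r) = 0 := by
    intro φ
    have hsmul : ∀ (a : ℝ) (z : ℂ), φ (a * z) = a * φ z := fun a z => by
      rw [← Complex.real_smul, map_smul, smul_eq_mul]
    have hdiv : ∀ (a : ℝ) (z : ℂ), φ (z / a) = φ z / a := fun a z => by
      rw [div_eq_inv_mul, ← Complex.ofReal_inv, hsmul, div_eq_inv_mul]
    refine radial_eq_zero (u := fun r => φ (u r)) (u₁ := fun r => φ (deriv u r))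
      (u₂ := fun r => φ (deriv (deriv u) r)) hrm hrmp (by linarith) (by linarith) hL hμd
      hμ₁.continuousOn hμm hμp hμm' hμp' hμpos hμne
      (fun r hr => φ.hasFDerivAt.comp_hasDerivAt r (hud r hr))
      (fun r hr => φ.hasFDerivAt.comp_hasDerivAt r (hu₁d r hr)) (fun r hr hr0 => ?_)
    have h := congrArg φ (hode r hr hr0)
    rw [map_add, hsmul, hsmul, map_sub, hdiv, ← Complex.ofReal_pow, hdiv, hsmul] at h
    exact h
  exact fun r hr => Complex.ext (hreal Complex.reCLM r hr) (hreal Complex.imCLM r hr)
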